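/- Under the assumptions ‖U_t‖ ≤ 3‖U♮‖, σ_min(U_tW_t) ≥ σ_min(U♮)/√10, and ‖V_{X♮⊥}ᵀV_{U_tW_t}‖ ≤ c·κ_f^{-2} for a sufficiently small constant c > 0, the spectral-norm bound ‖V_{X♮⊥}ᵀU_tU_tᵀ‖ ≤ 3·‖V_{X♮}ᵀ(X♮ − U_tU_tᵀ)‖ + ‖U_tW_{t,⊥}W_{t,⊥}ᵀU_tᵀ‖ holds. -/

import Mathlib

open scoped BigOperators
open Matrix MeasureTheory ProbabilityTheory

noncomputable section

/-- Euclidean (ℓ²) norm of a vector in `ℝ^n`. -/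
def vecNorm {n : ℕ} (v : Fin n → ℝ) : ℝ := Real.sqrt (∑ i, (v i) ^ 2)

/-- Frobenius norm of a matrix. -/
def frobNorm {m n : ℕ} (A : Matrix (Fin m) (Fin n) ℝ) : ℝ :=
  Real.sqrt (∑ i, ∑ j, (A i j) ^ 2)

/-- The `k`-th largest singular value of a matrix, via the Courant–Fischer
min-max characterization. -/
def singVal {m n : ℕ} (A : Matrix (Fin m) (Fin n) ℝ) (k : ℕ) : ℝ :=
  sSup {c : ℝ | 0 ≤ c ∧ ∃ V : Submodule ℝ (Fin n → ℝ),
    Module.finrank ℝ V = k ∧ ∀ x ∈ V, c * vecNorm x ≤ vecNorm (A.mulVec x)}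

/-- Spectral (operator) norm: the largest singular value. -/
def specNorm {m n : ℕ} (A : Matrix (Fin m) (Fin n) ℝ) : ℝ := singVal A 1

/-- Nuclear norm: the sum of all singular values. -/
def nucNorm {m n : ℕ} (A : Matrix (Fin m) (Fin n) ℝ) : ℝ :=
  ∑ k ∈ Finset.Icc 1 (min m n), singVal A k

section L2OperatorNorm

open scoped Matrix.Norms.L2Operator

/-- `vecNorm` is the Euclidean norm. -/
theorem vecNorm_eq_norm {n : ℕ} (v : Fin n → ℝ) : vecNorm v = ‖WithLp.toLp 2 v‖ := by
  simp [vecNorm, EuclideanSpace.norm_eq]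

theorem vecNorm_nonneg {n : ℕ} (v : Fin n → ℝ) : 0 ≤ vecNorm v := Real.sqrt_nonneg _

theorem vecNorm_pos {n : ℕ} {v : Fin n → ℝ} (hv : v ≠ 0) : 0 < vecNorm v := by
  rw [vecNorm_eq_norm, norm_pos_iff]
  simpa using hv

theorem vecNorm_smul {n : ℕ} (a : ℝ) (v : Fin n → ℝ) : vecNorm (a • v) = |a| * vecNorm v := by
  simp only [vecNorm_eq_norm, WithLp.toLp_smul, norm_smul, Real.norm_eq_abs]

theorem vecNorm_mulVec_le {m n : ℕ} (A : Matrix (Fin m) (Fin n) ℝ) (v : Fin n → ℝ) :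
    vecNorm (A.mulVec v) ≤ ‖A‖ * vecNorm v := by
  rw [vecNorm_eq_norm, vecNorm_eq_norm]
  exact A.l2_opNorm_mulVec (WithLp.toLp 2 v)

/-- Lower bounds of `A` on a nontrivial subspace are at most the operator norm of `A`. -/
theorem le_l2_opNorm_of_forall_mem {m n : ℕ} (A : Matrix (Fin m) (Fin n) ℝ) {c : ℝ}
    {V : Submodule ℝ (Fin n → ℝ)} (hV : 0 < Module.finrank ℝ V)
    (h : ∀ x ∈ V, c * vecNorm x ≤ vecNorm (A.mulVec x)) : c ≤ ‖A‖ := by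
  obtain ⟨x, hxV, hx⟩ := V.exists_mem_ne_zero_of_ne_bot (by rintro rfl; simp at hV)
  exact le_of_mul_le_mul_right ((h x hxV).trans (vecNorm_mulVec_le A x)) (vecNorm_pos hx)

theorem singVal_le_l2_opNorm {m n k : ℕ} (A : Matrix (Fin m) (Fin n) ℝ) (hk : 0 < k) :
    singVal A k ≤ ‖A‖ := by
  refine Real.sSup_le ?_ (norm_nonneg A)
  rintro c ⟨-, V, hV, h⟩
  exact le_l2_opNorm_of_forall_mem A (hV ▸ hk) h

theorem singVal_nonneg {m n : ℕ} (A : Matrix (Fin m) (Fin n) ℝ) (k : ℕ) : 0 ≤ singVal A k :=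
  Real.sSup_nonneg fun _ hc => hc.1

/-- Every nonnegative real belongs to the unbounded set that defines `singVal A 0`. -/
theorem singVal_zero {m n : ℕ} (A : Matrix (Fin m) (Fin n) ℝ) : singVal A 0 = 0 := by
  refine Real.sSup_of_not_bddAbove ?_
  rintro ⟨b, hb⟩
  have : |b| + 1 ≤ b := hb ⟨by positivity, ⊥, by simp, by
    intro x hx
    simp [(Submodule.mem_bot ℝ).1 hx, vecNorm]⟩
  linarith [le_abs_self b]

/-- `specNorm` is the `ℓ²` operator norm. -/
theorem specNorm_eq_l2_opNorm {m n : ℕ} (A : Matrix (Fin m) (Fin n) ℝ) : specNorm A = ‖A‖ := by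
  refine le_antisymm (singVal_le_l2_opNorm A one_pos) ?_
  rw [Matrix.l2_opNorm_def]
  refine ContinuousLinearMap.opNorm_le_bound _ (singVal_nonneg A 1) fun x => ?_
  change ‖WithLp.toLp 2 (A.mulVec x.ofLp)‖ ≤ specNorm A * ‖WithLp.toLp 2 x.ofLp‖
  rw [← vecNorm_eq_norm, ← vecNorm_eq_norm]
  generalize x.ofLp = v
  rcases eq_or_ne v 0 with rfl | hv
  · simp [vecNorm]
  rw [← div_le_iff₀ (vecNorm_pos hv)]
  refine le_csSup ⟨‖A‖, ?_⟩ ⟨div_nonneg (vecNorm_nonneg _) (vecNorm_nonneg _),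
    Submodule.span ℝ {v}, finrank_span_singleton hv, ?_⟩
  · rintro c ⟨-, V, hV, h⟩
    exact le_l2_opNorm_of_forall_mem A (hV ▸ one_pos) h
  · intro y hy
    obtain ⟨a, rfl⟩ := Submodule.mem_span_singleton.1 hy
    have hv0 : vecNorm v ≠ 0 := (vecNorm_pos hv).ne'
    rw [Matrix.mulVec_smul, vecNorm_smul, vecNorm_smul, mul_left_comm, div_mul_cancel₀ _ hv0]

/-- The inverse square of the ratio `σ₁ / σ_k` is at most one. -/
theorem inv_sq_specNorm_div_singVal_le_one {m n : ℕ} (A : Matrix (Fin m) (Fin n) ℝ) (k : ℕ) :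
    ((specNorm A / singVal A k) ^ 2)⁻¹ ≤ 1 := by
  rcases (singVal_nonneg A k).eq_or_lt with h | h
  · simp [← h]
  have hk : 0 < k := by
    rcases Nat.eq_zero_or_pos k with rfl | hk
    · simp [singVal_zero] at h
    · exact hk
  refine inv_le_one_of_one_le₀ (one_le_pow₀ ?_)
  rw [one_le_div h, specNorm_eq_l2_opNorm]
  exact singVal_le_l2_opNorm A hk

variable {l m n p : Type*} [Fintype l] [Fintype m] [Fintype n] [Fintype p]
  [DecidableEq l] [DecidableEq n]

theorem l2_opNorm_le_one_of_transpose_mul_self {V : Matrix m n ℝ} (hV : Vᵀ * V = 1) :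
    ‖V‖ ≤ 1 := by
  have h := Matrix.l2_opNorm_conjTranspose_mul_self V
  rw [Matrix.conjTranspose_eq_transpose_of_trivial, hV] at h
  have h1 : ‖(1 : Matrix n n ℝ)‖ ≤ 1 := by
    rw [Matrix.cstar_norm_def, map_one]
    exact ContinuousLinearMap.norm_id_le
  nlinarith [norm_nonneg V]

theorem l2_opNorm_mul_le_of_transpose_mul_self {V : Matrix m n ℝ} (hV : Vᵀ * V = 1)
    (A : Matrix n l ℝ) : ‖V * A‖ ≤ ‖A‖ :=
  (Matrix.l2_opNorm_mul V A).trans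
    (mul_le_of_le_one_left (norm_nonneg A) (l2_opNorm_le_one_of_transpose_mul_self hV))

variable [DecidableEq m] [DecidableEq p]

theorem l2_opNorm_transpose (A : Matrix m n ℝ) : ‖Aᵀ‖ = ‖A‖ := by
  rw [← Matrix.conjTranspose_eq_transpose_of_trivial, Matrix.l2_opNorm_conjTranspose]

theorem l2_opNorm_transpose_mul_le_of_transpose_mul_self {V : Matrix m n ℝ} (hV : Vᵀ * V = 1)
    (A : Matrix m l ℝ) : ‖Vᵀ * A‖ ≤ ‖A‖ :=
  (Matrix.l2_opNorm_mul Vᵀ A).trans (mul_le_of_le_one_left (norm_nonneg A)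
    ((l2_opNorm_transpose V).trans_le (l2_opNorm_le_one_of_transpose_mul_self hV)))

theorem l2_opNorm_mul_le_right_of_transpose_mul_self {V : Matrix m n ℝ} (hV : Vᵀ * V = 1)
    (A : Matrix l m ℝ) : ‖A * V‖ ≤ ‖A‖ := by
  rw [← l2_opNorm_transpose, Matrix.transpose_mul]
  exact (l2_opNorm_transpose_mul_le_of_transpose_mul_self hV _).trans_eq (l2_opNorm_transpose A)

theorem l2_opNorm_le_add_of_complement {P : Matrix m n ℝ} {Q : Matrix m p ℝ}
    (hP : Pᵀ * P = 1) (hQ : Qᵀ * Q = 1) (hPQ : P * Pᵀ + Q * Qᵀ = 1) (A : Matrix m l ℝ) :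
    ‖A‖ ≤ ‖Pᵀ * A‖ + ‖Qᵀ * A‖ := by
  calc ‖A‖ = ‖P * (Pᵀ * A) + Q * (Qᵀ * A)‖ := by
        rw [← Matrix.mul_assoc, ← Matrix.mul_assoc, ← Matrix.add_mul, hPQ, Matrix.one_mul]
    _ ≤ ‖P * (Pᵀ * A)‖ + ‖Q * (Qᵀ * A)‖ := norm_add_le _ _
    _ ≤ ‖Pᵀ * A‖ + ‖Qᵀ * A‖ := add_le_add
        (l2_opNorm_mul_le_of_transpose_mul_self hP _)
        (l2_opNorm_mul_le_of_transpose_mul_self hQ _)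

/-- If the column space of `Y` is spanned by the orthonormal columns of `V` and makes a small angle
with the range of `P`, then the part of `Y * Yᵀ` in the complementary rows is controlled by its
off-diagonal block. -/
theorem l2_opNorm_complement_mul_le {P : Matrix m n ℝ} {Q : Matrix m p ℝ} {V Y : Matrix m l ℝ}
    (hP : Pᵀ * P = 1) (hQ : Qᵀ * Q = 1) (hPQ : P * Pᵀ + Q * Qᵀ = 1)
    (hV : Vᵀ * V = 1) (hY : V * Vᵀ * Y = Y) (hQV : ‖Qᵀ * V‖ ≤ 1 / 2) :
    ‖Qᵀ * (Y * Yᵀ)‖ ≤ 2 * ‖Pᵀ * (Y * Yᵀ) * Q‖ := by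
  have hYV : Y * Yᵀ * Q = V * (Vᵀ * (Y * Yᵀ) * Q) := by
    calc Y * Yᵀ * Q = V * Vᵀ * Y * Yᵀ * Q := by rw [hY]
      _ = V * (Vᵀ * (Y * Yᵀ) * Q) := by simp only [Matrix.mul_assoc]
  set Z := Vᵀ * (Y * Yᵀ) * Q
  have hQZ : ‖Qᵀ * (V * Z)‖ ≤ 1 / 2 * ‖Z‖ := by
    rw [← Matrix.mul_assoc]
    exact (Matrix.l2_opNorm_mul _ _).trans (mul_le_mul_of_nonneg_right hQV (norm_nonneg Z))
  have hZ : ‖Z‖ ≤ ‖V * Z‖ := by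
    calc ‖Z‖ = ‖Vᵀ * (V * Z)‖ := by rw [← Matrix.mul_assoc, hV, Matrix.one_mul]
      _ ≤ ‖V * Z‖ := l2_opNorm_transpose_mul_le_of_transpose_mul_self hV _
  have hVZ := l2_opNorm_le_add_of_complement hP hQ hPQ (V * Z)
  have hsymm : ‖Pᵀ * ((Y * Yᵀ) * Q)‖ = ‖Pᵀ * (Qᵀ * (Y * Yᵀ))ᵀ‖ := by
    simp [Matrix.transpose_mul]
  have hsplit := l2_opNorm_le_add_of_complement hP hQ hPQ (Qᵀ * (Y * Yᵀ))ᵀ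
  rw [l2_opNorm_transpose, ← hsymm] at hsplit
  have hdiag : (Qᵀ * (Y * Yᵀ))ᵀ = Y * Yᵀ * Q := by simp [Matrix.transpose_mul]
  rw [hdiag] at hsplit
  rw [Matrix.mul_assoc Pᵀ, hYV]
  rw [hYV] at hsplit
  linarith

/-- Perturbed form of `l2_opNorm_complement_mul_le`: `S` is `Y * Yᵀ` up to a remainder `R` that the
rows of `Pᵀ` do not see, and `X` vanishes on the range of `Q`. -/
theorem l2_opNorm_complement_mul_le_add {P : Matrix m n ℝ} {Q : Matrix m p ℝ}
    {V Y : Matrix m l ℝ} {S X R : Matrix m m ℝ}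
    (hP : Pᵀ * P = 1) (hQ : Qᵀ * Q = 1) (hPQ : P * Pᵀ + Q * Qᵀ = 1)
    (hV : Vᵀ * V = 1) (hY : V * Vᵀ * Y = Y) (hQV : ‖Qᵀ * V‖ ≤ 1 / 2)
    (hXQ : X * Q = 0) (hPS : Pᵀ * (Y * Yᵀ) = Pᵀ * S) (hS : S = Y * Yᵀ + R) :
    ‖Qᵀ * S‖ ≤ 2 * ‖Pᵀ * (X - S)‖ + ‖R‖ := by
  have hE : Pᵀ * (Y * Yᵀ) * Q = -(Pᵀ * (X - S) * Q) := by
    rw [hPS, Matrix.mul_sub, Matrix.sub_mul, Matrix.mul_assoc Pᵀ X, hXQ, Matrix.mul_zero, zero_sub,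
      neg_neg]
  have hmain := l2_opNorm_complement_mul_le hP hQ hPQ hV hY hQV
  rw [hE, norm_neg] at hmain
  have hEle := l2_opNorm_mul_le_right_of_transpose_mul_self hQ (Pᵀ * (X - S))
  have htri := norm_add_le (Qᵀ * (Y * Yᵀ)) (Qᵀ * R)
  rw [← Matrix.mul_add, ← hS] at htri
  have hrest := l2_opNorm_transpose_mul_le_of_transpose_mul_self hQ R
  linarith

end L2OperatorNorm

/-- `‖V_{X♮⊥}ᵀ U_tU_tᵀ‖ ≤ 3‖V_{X♮}ᵀ(X♮ − U_tU_tᵀ)‖ + ‖U_tW_{t,⊥}W_{t,⊥}ᵀU_tᵀ‖`. -/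
theorem lemma_error_bound_one :
    ∃ c : ℝ, 0 < c ∧
      ∀ (n r rstar : ℕ)
        (Unat : Matrix (Fin n) (Fin rstar) ℝ) (Xnat : Matrix (Fin n) (Fin n) ℝ),
        Xnat = Unat * Unatᵀ → Xnat.rank = rstar →
        ∀ (kappaf : ℝ), kappaf = specNorm Unat / singVal Unat rstar →
        ∀ (Ut : Matrix (Fin n) (Fin r) ℝ)
          (VX : Matrix (Fin n) (Fin rstar) ℝ)
          (VXperp : Matrix (Fin n) (Fin (n - rstar)) ℝ)
          (W : Matrix (Fin r) (Fin rstar) ℝ)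
          (Wperp : Matrix (Fin r) (Fin (r - rstar)) ℝ)
          (VUW : Matrix (Fin n) (Fin rstar) ℝ),
        -- V_{X♮} is an orthonormal basis of the column space of X♮,
        -- V_{X♮⊥} of its orthogonal complement
        VXᵀ * VX = 1 → VX * VXᵀ * Xnat = Xnat →
        VXperpᵀ * VXperp = 1 → VX * VXᵀ + VXperp * VXperpᵀ = 1 →
        -- W_t comes from the SVD of V_{X♮}ᵀ U_t, and W_{t,⊥} is an orthonormal
        -- complement of W_t
        Wᵀ * W = 1 → VXᵀ * Ut * (W * Wᵀ) = VXᵀ * Ut →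
        Wperpᵀ * Wperp = 1 → Wᵀ * Wperp = 0 → W * Wᵀ + Wperp * Wperpᵀ = 1 →
        -- V_{U_tW_t} is an orthonormal basis of the column space of U_tW_t
        VUWᵀ * VUW = 1 → VUW * VUWᵀ * (Ut * W) = Ut * W →
        -- assumptions
        specNorm Ut ≤ 3 * specNorm Unat →
        singVal Unat rstar / Real.sqrt 10 ≤ singVal (Ut * W) rstar →
        specNorm (VXperpᵀ * VUW) ≤ c * (kappaf ^ 2)⁻¹ →
        specNorm (VXperpᵀ * (Ut * Utᵀ)) ≤
          3 * specNorm (VXᵀ * (Xnat - Ut * Utᵀ)) + specNorm (Ut * Wperp * Wperpᵀ * Utᵀ) := by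
  refine ⟨1 / 2, by norm_num, ?_⟩
  intro n r rstar Unat Xnat hX _ kappaf hkappa Ut VX VXperp W Wperp VUW hVX hVXX hQ hPQ
    _ hUW _ _ hWsum hV hVU _ _ hangle
  have hsmall : specNorm (VXperpᵀ * VUW) ≤ 1 / 2 := by
    have := inv_sq_specNorm_div_singVal_le_one Unat rstar
    rw [← hkappa] at this
    linarith
  have hpos : 0 ≤ specNorm (VXᵀ * (Xnat - Ut * Utᵀ)) := singVal_nonneg _ 1
  simp only [specNorm_eq_l2_opNorm] at hsmall hpos ⊢
  have hXsymm : Xnatᵀ = Xnat := by simp [hX, Matrix.transpose_mul]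
  have hQX : Xnat * VXperp = 0 := by
    have h1 : Xnat * (VX * VXᵀ) = Xnat := by
      simpa [Matrix.transpose_mul, hXsymm] using congrArg Matrix.transpose hVXX
    have h2 : Xnat * (VXperp * VXperpᵀ) = 0 := by
      rw [← add_right_inj (Xnat * (VX * VXᵀ)), ← Matrix.mul_add, hPQ, h1, Matrix.mul_one, add_zero]
    calc Xnat * VXperp = Xnat * (VXperp * VXperpᵀ) * VXperp := by
          rw [Matrix.mul_assoc, Matrix.mul_assoc VXperp, hQ, Matrix.mul_one]
      _ = 0 := by rw [h2, Matrix.zero_mul]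
  have hblock : VXᵀ * (Ut * W * (Ut * W)ᵀ) = VXᵀ * (Ut * Utᵀ) := by
    calc VXᵀ * (Ut * W * (Ut * W)ᵀ) = VXᵀ * Ut * (W * Wᵀ) * Utᵀ := by
          simp only [Matrix.transpose_mul, Matrix.mul_assoc]
      _ = VXᵀ * (Ut * Utᵀ) := by rw [hUW, Matrix.mul_assoc]
  have hsum : Ut * Utᵀ = Ut * W * (Ut * W)ᵀ + Ut * Wperp * Wperpᵀ * Utᵀ := by
    calc Ut * Utᵀ = Ut * (W * Wᵀ + Wperp * Wperpᵀ) * Utᵀ := by rw [hWsum, Matrix.mul_one]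
      _ = _ := by
          simp only [Matrix.transpose_mul, Matrix.mul_assoc, Matrix.mul_add, Matrix.add_mul]
  refine (l2_opNorm_complement_mul_le_add hVX hQ hPQ hV hVU hsmall hQX hblock hsum).trans ?_
  linarith
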